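/- Fix an integer m ≥ 2. For every monotone configuration η ∈ X_{m-1}, lim_{n→∞} K_{m-1,n}(η) = m · K_{m-1}(η); indeed K_{m-1,n}(η) = m · K_{m-1}(η) for every n such that n − |η| > η_{m-1} (i.e., as soon as the added coordinate n − |η| strictly exceeds the largest coordinate of η). -/

import Mathlib

open Filter Topology

noncomputable section

/-- The order operator `𝔒`: rearrange the coordinates of a configuration in
nondecreasing order. -/
def ord {m : ℕ} (ξ : Fin m → ℕ) : Fin m → ℕ := ξ ∘ Tuple.sort ξ

/-- The cut operator `ℭ`: delete the last coordinate of a configuration. -/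
def cut {m : ℕ} (ξ : Fin m → ℕ) : Fin (m - 1) → ℕ :=
  fun i => ξ (Fin.castLE (Nat.sub_le m 1) i)

/-- `K_k(ζ)`: the number of configurations of `ℕ^k` whose ordering is `ζ`. -/
def K {k : ℕ} (ζ : Fin k → ℕ) : ℕ := Nat.card {ξ : Fin k → ℕ // ord ξ = ζ}

/-- `K_{m-1,n}(η)`: the number of configurations of `ℕ^m` with `n` particles whose
ordering followed by cutting gives `η`. -/
def Kn (m n : ℕ) (η : Fin (m - 1) → ℕ) : ℕ :=
  Nat.card {ξ : Fin m → ℕ // (∑ j, ξ j) = n ∧ cut (ord ξ) = η}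

/-- The canonical measure `ν_{m,n}`, i.e. the grand canonical measure conditioned on
configurations with `n` particles. -/
def nu (f : ℕ → ℝ) (m n : ℕ) (ξ : Fin m → ℕ) : ℝ :=
  if (∑ j, ξ j) = n then
    (∏ j, f (ξ j)) / ∑' ξ' : {ξ' : Fin m → ℕ // (∑ j, ξ' j) = n}, ∏ j, f (ξ'.1 j)
  else 0

/-- The grand canonical measure `μ_{m,φ}`. -/
def mu (f : ℕ → ℝ) (m : ℕ) (φ : ℝ) (ξ : Fin m → ℕ) : ℝ :=
  (∏ j, φ ^ (ξ j) * f (ξ j)) / (∑' k : ℕ, φ ^ k * f k) ^ m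

/-- The ordered-and-cut canonical measure `ν̂_{m-1,n} = ν_{m,n} ∘ (ℭ ∘ 𝔒)⁻¹`. -/
def nuHat (f : ℕ → ℝ) (m n : ℕ) (η : Fin (m - 1) → ℕ) : ℝ :=
  ∑' ξ : {ξ : Fin m → ℕ // (∑ j, ξ j) = n ∧ cut (ord ξ) = η}, nu f m n ξ.1

/-- The ordered grand canonical measure `μ̂_{k,φ} = μ_{k,φ} ∘ 𝔒⁻¹`. -/
def muHat (f : ℕ → ℝ) (k : ℕ) (φ : ℝ) (ζ : Fin k → ℕ) : ℝ :=
  ∑' ξ : {ξ : Fin k → ℕ // ord ξ = ζ}, mu f k φ ξ.1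

def ms {k : ℕ} (ξ : Fin k → ℕ) : Multiset ℕ := Finset.univ.val.map ξ

lemma ms_ord {k : ℕ} (ξ : Fin k → ℕ) : ms (ord ξ) = ms ξ := by
  unfold ms ord
  rw [← Multiset.map_map, Multiset.map_univ_val_equiv]

lemma ms_inj {k : ℕ} {a b : Fin k → ℕ} (ha : Monotone a) (hb : Monotone b)
    (h : ms a = ms b) : a = b := by
  unfold ms at h
  rw [Fin.univ_val_map, Fin.univ_val_map, Multiset.coe_eq_coe] at h
  apply List.ofFn_injective
  exact h.eq_of_pairwise (le := (· ≤ ·)) (fun _ _ _ _ h1 h2 => le_antisymm h1 h2)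
    (List.sortedLE_ofFn_iff.2 ha).pairwise (List.sortedLE_ofFn_iff.2 hb).pairwise

lemma ord_mono {k : ℕ} (ξ : Fin k → ℕ) : Monotone (ord ξ) := Tuple.monotone_sort ξ

lemma ord_iff {k : ℕ} {θ : Fin k → ℕ} (hθ : Monotone θ) (ξ : Fin k → ℕ) :
    ord ξ = θ ↔ ms ξ = ms θ := by
  constructor
  · rintro rfl; exact (ms_ord ξ).symm
  · intro h; exact ms_inj (ord_mono ξ) hθ ((ms_ord ξ).trans h)

lemma ms_sum {k : ℕ} (ξ : Fin k → ℕ) : (ms ξ).sum = ∑ i, ξ i := rfl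

lemma ms_insertNth {k : ℕ} (p : Fin (k+1)) (N : ℕ) (ζ : Fin k → ℕ) :
    ms (p.insertNth (α := fun _ => ℕ) N ζ) = N ::ₘ ms ζ := by
  unfold ms
  rw [Fin.univ_succAbove k p]
  simp [Function.comp_def]

lemma set_iff {k : ℕ} {η : Fin k → ℕ} (hη : Monotone η) (N : ℕ) (hN : ∀ i, η i < N)
    (ξ : Fin (k+1) → ℕ) :
    ((∑ j, ξ j) = (∑ i, η i) + N ∧ cut (ord ξ) = η) ↔ ms ξ = N ::ₘ ms η := by
  have hmono : Monotone (Fin.snoc (α := fun _ => ℕ) η N : Fin (k+1) → ℕ) := by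
    intro i j hij
    induction j using Fin.lastCases with
    | last =>
      induction i using Fin.lastCases with
      | last => simp
      | cast i => simpa using (hN i).le
    | cast j =>
      induction i using Fin.lastCases with
      | last => exact absurd hij (not_le.2 (Fin.castSucc_lt_last j))
      | cast i => simpa using hη (by simpa using hij)
  have hms : ms (Fin.snoc (α := fun _ => ℕ) η N : Fin (k+1) → ℕ) = N ::ₘ ms η := by
    rw [← Fin.insertNth_last', ms_insertNth]
  rw [← hms, ← ord_iff hmono]
  constructor
  · rintro ⟨h1, h2⟩
    have hc : ∀ i : Fin k, ord ξ i.castSucc = η i := fun i => congrFun h2 i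
    have hs : ∑ j, ord ξ j = (∑ i, η i) + N := by
      rw [← h1, ← ms_sum, ms_ord, ms_sum]
    rw [Fin.sum_univ_castSucc] at hs
    simp only [hc] at hs
    funext j
    induction j using Fin.lastCases with
    | last => simpa using hs
    | cast j => simpa using hc j
  · intro h
    constructor
    · rw [← ms_sum, ← ms_ord, h, ms_sum, Fin.sum_univ_castSucc]
      simp
    · funext i
      have : ord ξ i.castSucc = η i := by rw [h]; simp
      exact this

lemma card_eq {k : ℕ} {η : Fin k → ℕ} (hη : Monotone η) (N : ℕ) (hN : ∀ i, η i < N) :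
    Nat.card {ξ : Fin (k+1) → ℕ // (∑ j, ξ j) = (∑ i, η i) + N ∧ cut (ord ξ) = η}
      = (k+1) * K η := by
  have hnot : ∀ ζ : Fin k → ℕ, ms ζ = ms η → ∀ j, ζ j ≠ N := by
    intro ζ h j hj
    have : N ∈ ms ζ := Multiset.mem_map.2 ⟨j, by simp, hj⟩
    rw [h] at this
    obtain ⟨i, -, hi⟩ := Multiset.mem_map.1 this
    exact (hN i).ne hi
  let f : Fin (k+1) × {ζ : Fin k → ℕ // ord ζ = η} →
      {ξ : Fin (k+1) → ℕ // (∑ j, ξ j) = (∑ i, η i) + N ∧ cut (ord ξ) = η} :=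
    fun x => ⟨x.1.insertNth (α := fun _ => ℕ) N x.2.1, (set_iff hη N hN _).2 (by
      rw [ms_insertNth, (ord_iff hη _).1 x.2.2])⟩
  have hf : Function.Bijective f := by
    constructor
    · rintro ⟨p, ζ, hζ⟩ ⟨q, ζ', hζ'⟩ h
      have h : p.insertNth (α := fun _ => ℕ) N ζ = q.insertNth (α := fun _ => ℕ) N ζ' :=
        congrArg Subtype.val h
      have hpq : p = q := by
        by_contra hne
        obtain ⟨j, hj⟩ := Fin.exists_succAbove_eq hne
        have := congrFun h p
        rw [Fin.insertNth_apply_same, ← hj, Fin.insertNth_apply_succAbove] at this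
        exact hnot ζ' ((ord_iff hη _).1 hζ') j this.symm
      subst hpq
      have : ζ = ζ' := by
        funext j
        simpa using congrFun h (p.succAbove j)
      subst this
      rfl
    · rintro ⟨ξ, hξ⟩
      have h := (set_iff hη N hN _).1 hξ
      have hm : N ∈ ms ξ := by rw [h]; exact Multiset.mem_cons_self _ _
      obtain ⟨p, -, hp⟩ := Multiset.mem_map.1 hm
      have he : p.insertNth (α := fun _ => ℕ) N (p.removeNth ξ) = ξ := by
        rw [← hp]; exact Fin.insertNth_self_removeNth p ξ
      refine ⟨⟨p, p.removeNth ξ, (ord_iff hη _).2 ?_⟩, Subtype.ext he⟩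
      rw [← he, ms_insertNth] at h
      exact (Multiset.cons_inj_right N).1 h
  rw [← Nat.card_congr (Equiv.ofBijective f hf), Nat.card_prod]
  simp [K]

/-- **Lemma (second part).** For every monotone configuration `η ∈ X_{m-1}`,
`K_{m-1,n}(η) → m ⬝ K_{m-1}(η)` as `n → ∞`; indeed `K_{m-1,n}(η) = m ⬝ K_{m-1}(η)`
as soon as the added coordinate `n - |η|` strictly exceeds the largest coordinate
`η_{m-1}` of `η`. -/
theorem Kn_tendsto_mul_K
    (m : ℕ) (hm : 2 ≤ m)
    (η : Fin (m - 1) → ℕ) (hη : Monotone η) :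
    Tendsto (fun n => Kn m n η) atTop (𝓝 (m * K η)) ∧
    ∀ n : ℕ, (∑ i, η i) + η ⟨m - 2, by omega⟩ < n → Kn m n η = m * K η := by
  have key : ∀ n : ℕ, (∑ i, η i) + η ⟨m - 2, by omega⟩ < n → Kn m n η = m * K η := by
    intro n hn
    obtain ⟨k, rfl⟩ : ∃ k, m = k + 1 := ⟨m - 1, by omega⟩
    obtain ⟨N, rfl⟩ := Nat.exists_eq_add_of_le (show (∑ i, η i) ≤ n by omega)
    refine card_eq (k := k) hη N fun i => ?_
    have h1 : η i ≤ η ⟨k + 1 - 2, by omega⟩ := hη (by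
      have := i.2
      rw [Fin.le_def]
      simp only
      omega)
    omega
  refine ⟨?_, key⟩
  apply tendsto_const_nhds.congr'
  filter_upwards [eventually_gt_atTop ((∑ i, η i) + η ⟨m - 2, by omega⟩)] with n hn
  exact (key n hn).symm

end
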